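/- arXiv:math/0612740 — 2 statements merged into one kernel-verified Lean document; each statement's English description precedes it below -/
import Mathlib

section
/- Let Y be a code in the Hamming scheme H(D,q) with minimum distance δ, dual distance δ^*, and dual degree s^*. Then δ ≤ δ^* + s^* − 1, unless q = 2 and Y is a binary repetition code. -/
open Matrix

noncomputable section

/-- The characteristic vector of a subset. -/
def chiv {X : Type*} [DecidableEq X] (Y : Finset X) : X → ℂ := fun y => if y ∈ Y then 1 else 0

/-- The `i`-th associate matrix of the Hamming scheme `H(D,q)`:
`(A_i)_{x y} = 1` iff the Hamming distance of `x` and `y` is `i`. -/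
def hammingA (D q : ℕ) (i : ℕ) : Matrix (Fin D → Fin q) (Fin D → Fin q) ℂ :=
  Matrix.of fun x y => if hammingDist x y = i then 1 else 0

/-- The Krawtchouk polynomial value `K_j(i) = Σ_h (-1)^h (q-1)^{j-h} C(i,h) C(D-i,j-h)`. -/
def kraw (D q : ℕ) (j i : ℕ) : ℂ :=
  ∑ h ∈ Finset.range (j + 1),
    (-1 : ℂ) ^ h * ((q : ℂ) - 1) ^ (j - h) * (Nat.choose i h : ℂ) *
      (Nat.choose (D - i) (j - h) : ℂ)

/-- The `j`-th primitive (Krawtchouk) idempotent of the Hamming scheme `H(D,q)`: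
`E_j = q^{-D} Σ_i K_j(i) A_i`. -/
def hammingE (D q : ℕ) (j : ℕ) : Matrix (Fin D → Fin q) (Fin D → Fin q) ℂ :=
  ((q : ℂ) ^ D)⁻¹ • ∑ i ∈ Finset.range (D + 1), kraw D q j i • hammingA D q i

/-- The minimum distance `δ(Y) = min { i ≠ 0 : some pair of words of Y is at distance i }`. -/
def hMinDist {D q : ℕ} (Y : Finset (Fin D → Fin q)) : ℕ :=
  sInf {i : ℕ | i ≠ 0 ∧ ∃ u ∈ Y, ∃ v ∈ Y, hammingDist u v = i}

/-- The degree `s(Y) = #{ i ≠ 0 : some pair of words of Y is at distance i }`. -/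
def hDeg {D q : ℕ} (Y : Finset (Fin D → Fin q)) : ℕ :=
  {i : ℕ | i ≠ 0 ∧ ∃ u ∈ Y, ∃ v ∈ Y, hammingDist u v = i}.ncard

/-- The set of nontrivial dual eigenvalues `{ j ≠ 0 : E_j χ_Y ≠ 0 }` of `Y`. -/
def hDualSet (D q : ℕ) (Y : Finset (Fin D → Fin q)) : Set ℕ :=
  {j : ℕ | j ≠ 0 ∧ j ≤ D ∧ (hammingE D q j).mulVec (chiv Y) ≠ 0}

/-- The dual distance `δ^*(Y)`. -/
def hDualDist (D q : ℕ) (Y : Finset (Fin D → Fin q)) : ℕ := sInf (hDualSet D q Y)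

/-- The dual degree `s^*(Y)`. -/
def hDualDeg (D q : ℕ) (Y : Finset (Fin D → Fin q)) : ℕ := (hDualSet D q Y).ncard

open Finset in
lemma interp_choose (M : Finset ℕ) (f : ℕ → ℂ) :
    ∃ c : ℕ → ℂ, ∀ m ∈ M, f m = ∑ k ∈ range M.card, c k * (m.choose k : ℂ) := by
  have hinj : Set.InjOn (fun m : ℕ => (m : ℂ)) (M : Set ℕ) := fun a _ b _ h => by
    simpa using h
  set p := Lagrange.interpolate M (fun m : ℕ => (m : ℂ)) f with hp
  have hdeg : p.degree < M.card := Lagrange.degree_interpolate_lt f hinj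
  refine ⟨fun k => (fwdDiff 1)^[k] (p.eval) 0, fun m hm => ?_⟩
  have h1 : p.eval (m : ℂ) = f m := Lagrange.eval_interpolate_at_node f hinj hm
  have hz : ∀ k, M.card ≤ k → (fwdDiff 1)^[k] (p.eval) (0 : ℂ) = 0 := by
    intro k hk
    by_cases hp0 : p = 0
    · have hc : M.card ≠ 0 := fun h => by
        rw [Finset.card_eq_zero] at h; simp [h] at hm
      rw [Polynomial.fwdDiff_iter_eq_zero_of_degree_lt]
      · rfl
      · rw [hp0]; simp; omega
    · rw [Polynomial.fwdDiff_iter_eq_zero_of_degree_lt]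
      · rfl
      · rw [Polynomial.degree_eq_natDegree hp0] at hdeg
        have : p.natDegree < M.card := by exact_mod_cast hdeg
        omega
  have h2 := shift_eq_sum_fwdDiff_iter (1 : ℂ) (p.eval) m 0
  simp only [zero_add, nsmul_eq_mul, mul_one] at h2
  rw [← h1, h2]
  have e1 : ∑ k ∈ range (m + 1), (m.choose k : ℂ) * (fwdDiff 1)^[k] (p.eval) 0
      = ∑ k ∈ range (m + 1 + M.card), (m.choose k : ℂ) * (fwdDiff 1)^[k] (p.eval) 0 := by
    apply sum_subset (by intro a; simp; omega)
    intro k _ hk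
    simp at hk
    rw [Nat.choose_eq_zero_of_lt (by omega)]; simp
  have e2 : ∑ k ∈ range M.card, (m.choose k : ℂ) * (fwdDiff 1)^[k] (p.eval) 0
      = ∑ k ∈ range (m + 1 + M.card), (m.choose k : ℂ) * (fwdDiff 1)^[k] (p.eval) 0 := by
    apply sum_subset (by intro a; simp; omega)
    intro k _ hk
    simp at hk
    rw [hz k hk]; simp
  rw [e1, ← e2]
  exact sum_congr rfl fun k _ => mul_comm _ _

/-- The local factor product attached to a coordinate set. -/
def eT {D q : ℕ} (T : Finset (Fin D)) (x z : Fin D → Fin q) : ℂ :=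
  ∏ i ∈ T, (if x i = z i then (q : ℂ) - 1 else -1)

open Finset Polynomial in
lemma esum_coeff {ι : Type*} [DecidableEq ι] (s : Finset ι) (a : ι → ℂ) (j : ℕ) :
    ∑ T ∈ powersetCard j s, ∏ i ∈ T, a i = (∏ i ∈ s, (1 + C (a i) * X)).coeff j := by
  rw [prod_one_add, finsetSum_coeff]
  have : ∀ T : Finset ι, (∏ i ∈ T, (C (a i) * X)).coeff j
      = if T.card = j then ∏ i ∈ T, a i else 0 := by
    intro T
    rw [prod_mul_distrib, prod_const, ← map_prod, coeff_C_mul_X_pow]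
    simp [eq_comm]
  simp_rw [this]
  rw [← sum_filter, powersetCard_eq_filter]

open Polynomial in
lemma coeff_one_add_C_mul_X_pow' (a : ℂ) (n k : ℕ) :
    ((1 + C a * X) ^ n).coeff k = a ^ k * (n.choose k : ℂ) := by
  have : (1 + C a * X : ℂ[X]) = (1 + X).comp (C a * X) := by simp
  rw [this, ← pow_comp, comp_C_mul_X_coeff, coeff_one_add_X_pow, mul_comm]

open Finset Polynomial in
lemma kraw_eq {D q : ℕ} (j : ℕ) (x z : Fin D → Fin q) :
    kraw D q j (hammingDist x z) = ∑ T ∈ powersetCard j univ, eT T x z := by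
  unfold eT
  rw [esum_coeff]
  have h : ∏ i : Fin D, (1 + C (if x i = z i then (q : ℂ) - 1 else -1) * X)
      = (1 + C (-1 : ℂ) * X) ^ (hammingDist x z) * (1 + C ((q : ℂ) - 1) * X) ^ (D - hammingDist x z) := by
    rw [← prod_filter_mul_prod_filter_not univ (fun i => x i ≠ z i)]
    congr 1
    · rw [prod_congr rfl (g := fun _ => (1 + C (-1 : ℂ) * X))]
      · rw [prod_const]; rfl
      · intro i hi; simp at hi; simp [hi]
    · rw [prod_congr rfl (g := fun _ => (1 + C ((q : ℂ) - 1) * X))]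
      · rw [prod_const]
        congr 1
        have := card_filter_add_card_filter_not (s := (univ : Finset (Fin D))) (fun i => x i ≠ z i)
        simp only [card_univ, Fintype.card_fin] at this
        unfold hammingDist
        omega
      · intro i hi; simp at hi; simp [hi]
  rw [h, coeff_mul, Nat.sum_antidiagonal_eq_sum_range_succ_mk]
  unfold kraw
  refine sum_congr rfl fun k hk => ?_
  simp only [coeff_one_add_C_mul_X_pow']
  ring

/-- The (unnormalised) component of the characteristic vector. -/
def gG {D q : ℕ} (Y : Finset (Fin D → Fin q)) (j : ℕ) (x : Fin D → Fin q) : ℂ :=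
  ∑ z ∈ Y, ∑ T ∈ Finset.powersetCard j Finset.univ, eT T x z

lemma hammingE_mulVec {D q : ℕ} (Y : Finset (Fin D → Fin q)) (j : ℕ) (x : Fin D → Fin q) :
    (hammingE D q j).mulVec (chiv Y) x = ((q : ℂ) ^ D)⁻¹ * gG Y j x := by
  have hE : ∀ z, hammingE D q j x z
      = ((q : ℂ) ^ D)⁻¹ * ∑ T ∈ Finset.powersetCard j Finset.univ, eT T x z := by
    intro z
    rw [← kraw_eq]
    unfold hammingE hammingA
    rw [Matrix.smul_apply, Matrix.sum_apply]
    simp only [Matrix.smul_apply, Matrix.of_apply, smul_eq_mul, mul_ite, mul_one, mul_zero]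
    rw [Finset.sum_ite_eq, if_pos]
    have := hammingDist_le_card_fintype (x := x) (y := z)
    simp at this ⊢; omega
  unfold Matrix.mulVec dotProduct chiv gG
  simp only [hE, mul_ite, mul_one, mul_zero]
  rw [Finset.sum_ite_mem, Finset.univ_inter, Finset.mul_sum]

open Finset in
lemma gG_sum {D q : ℕ} (Y : Finset (Fin D → Fin q)) (k : ℕ) (hk : k ≤ D) (x : Fin D → Fin q) :
    ∑ j ∈ range (D + 1), ((D - j).choose k : ℂ) * gG Y j x
      = (q : ℂ) ^ (D - k) * ∑ z ∈ Y, ((D - hammingDist x z).choose (D - k) : ℂ) := by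
  have key : ∀ z, ∑ j ∈ range (D + 1), ((D - j).choose k : ℂ) *
      ∑ T ∈ powersetCard j univ, eT T x z
      = (q : ℂ) ^ (D - k) * ((D - hammingDist x z).choose (D - k) : ℂ) := by
    intro z
    have h1 : ∑ j ∈ range (D + 1), ((D - j).choose k : ℂ) * ∑ T ∈ powersetCard j univ, eT T x z
        = ∑ T : Finset (Fin D), ((D - T.card).choose k : ℂ) * eT T x z := by
      rw [← powerset_univ, sum_powerset (s := (univ : Finset (Fin D)))]
      simp only [card_univ, Fintype.card_fin]
      refine sum_congr rfl fun j _ => ?_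
      rw [mul_sum]
      refine sum_congr rfl fun T hT => ?_
      rw [(mem_powersetCard.1 hT).2]
    have h2 : ∀ T : Finset (Fin D), ((D - T.card).choose k : ℂ) * eT T x z
        = ∑ V ∈ powersetCard k univ, if T ⊆ Vᶜ then eT T x z else 0 := by
      intro T
      rw [← sum_filter, sum_const, nsmul_eq_mul]
      congr 2
      have : (powersetCard k (univ : Finset (Fin D))).filter (fun V => T ⊆ Vᶜ)
          = powersetCard k Tᶜ := by
        ext V
        simp only [mem_filter, mem_powersetCard, subset_univ, true_and]
        rw [Finset.subset_compl_comm]; tauto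
      rw [this, card_powersetCard, card_compl, Fintype.card_fin]
    rw [h1, sum_congr rfl (fun T _ => h2 T), sum_comm]
    have h3 : ∀ V ∈ powersetCard k (univ : Finset (Fin D)),
        (∑ T : Finset (Fin D), if T ⊆ Vᶜ then eT T x z else 0)
        = if Vᶜ ⊆ univ.filter (fun i => x i = z i) then (q : ℂ) ^ (D - k) else 0 := by
      intro V hV
      rw [← sum_filter]
      have : (univ : Finset (Finset (Fin D))).filter (fun T => T ⊆ Vᶜ) = Vᶜ.powerset := by
        ext T; simp
      rw [this]
      unfold eT
      rw [← prod_one_add]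
      have hc : Vᶜ.card = D - k := by
        rw [card_compl, Fintype.card_fin, (mem_powersetCard.1 hV).2]
      split_ifs with h
      · rw [← hc, ← prod_const]
        refine prod_congr rfl fun i hi => ?_
        have := h hi
        simp at this
        simp [this]
      · obtain ⟨i, hi, hi'⟩ := not_subset.1 h
        apply prod_eq_zero hi
        simp at hi'
        simp [hi']
    rw [sum_congr rfl h3, ← sum_filter, sum_const, nsmul_eq_mul, mul_comm]
    congr 2
    have : ((powersetCard k (univ : Finset (Fin D))).filter
        (fun V => Vᶜ ⊆ univ.filter (fun i => x i = z i))).card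
        = (powersetCard (D - k) (univ.filter (fun i => x i = z i))).card := by
      apply card_bij (fun V _ => Vᶜ)
      · intro V hV
        simp only [mem_filter, mem_powersetCard] at hV ⊢
        simp only [mem_filter, mem_powersetCard, card_compl, Fintype.card_fin]
        exact ⟨hV.2, by rw [hV.1.2]⟩
      · intro a _ b _ h
        exact compl_injective h
      · intro W hW
        simp only [mem_powersetCard] at hW
        refine ⟨Wᶜ, ?_, compl_compl W⟩
        simp only [mem_filter, mem_powersetCard, card_compl, Fintype.card_fin, compl_compl,
          subset_univ, true_and]
        exact ⟨by omega, hW.1⟩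
    rw [this, card_powersetCard]
    congr 1
    have := card_filter_add_card_filter_not (s := (univ : Finset (Fin D))) (fun i => x i ≠ z i)
    simp only [card_univ, Fintype.card_fin, not_not] at this
    unfold hammingDist
    omega
  unfold gG
  simp_rw [mul_sum (s := Y)]
  rw [sum_comm]
  exact sum_congr rfl fun z _ => key z

lemma mem_hDualSet {D q : ℕ} (hq : 2 ≤ q) (Y : Finset (Fin D → Fin q)) (j : ℕ) :
    j ∈ hDualSet D q Y ↔ j ≠ 0 ∧ j ≤ D ∧ ∃ x, gG Y j x ≠ 0 := by
  have hq0 : ((q : ℂ) ^ D)⁻¹ ≠ 0 := by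
    apply inv_ne_zero; apply pow_ne_zero; exact_mod_cast (by omega : q ≠ 0)
  unfold hDualSet
  simp only [Set.mem_setOf_eq]
  rw [Function.ne_iff]
  simp only [hammingE_mulVec, Pi.zero_apply, mul_ne_zero_iff, hq0, ne_eq, not_false_eq_true,
    true_and]

lemma hDualSet_finite (D q : ℕ) (Y : Finset (Fin D → Fin q)) : (hDualSet D q Y).Finite :=
  (Set.finite_Iic D).subset fun _ h => h.2.1

open Finset in
lemma gG_zero {D q : ℕ} (Y : Finset (Fin D → Fin q)) (x : Fin D → Fin q) :
    gG Y 0 x = Y.card := by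
  simp [gG, eT]

open Finset in
lemma sum_split {D q : ℕ} (hq : 2 ≤ q) (Y : Finset (Fin D → Fin q)) (k : ℕ)
    (x : Fin D → Fin q) :
    ∑ j ∈ range (D + 1), ((D - j).choose k : ℂ) * gG Y j x
      = (D.choose k : ℂ) * Y.card
        + ∑ j ∈ (hDualSet_finite D q Y).toFinset, ((D - j).choose k : ℂ) * gG Y j x := by
  rw [sum_range_succ', add_comm, gG_zero]
  congr 1
  have := sum_image (s := range D) (g := fun j => j + 1)
    (f := fun j => ((D - j).choose k : ℂ) * gG Y j x) (by intro a _ b _ h; simpa using h)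
  rw [← this]
  symm
  apply sum_subset
  · intro j hj
    rw [Set.Finite.mem_toFinset, mem_hDualSet hq] at hj
    simp only [mem_image, mem_range]
    exact ⟨j - 1, by omega, by omega⟩
  · intro j hj hj'
    rw [Set.Finite.mem_toFinset, mem_hDualSet hq] at hj'
    simp only [mem_image, mem_range] at hj
    obtain ⟨a, ha, rfl⟩ := hj
    have : gG Y (a + 1) x = 0 := by
      by_contra h
      exact hj' ⟨by omega, by omega, x, h⟩
    rw [this, mul_zero]

lemma hDualDeg_eq (D q : ℕ) (Y : Finset (Fin D → Fin q)) :
    hDualDeg D q Y = (hDualSet_finite D q Y).toFinset.card := by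
  unfold hDualDeg
  rw [Set.ncard_eq_toFinset_card _ (hDualSet_finite D q Y)]

open Finset in
lemma hDualDeg_le {D q : ℕ} (Y : Finset (Fin D → Fin q)) : hDualDeg D q Y ≤ D := by
  rw [hDualDeg_eq]
  have : (hDualSet_finite D q Y).toFinset ⊆ Icc 1 D := by
    intro j hj
    rw [Set.Finite.mem_toFinset] at hj
    have h1 := hj.1
    have h2 := hj.2.1
    simp; omega
  simpa using card_le_card this

open Finset in
lemma regular_rel {D q : ℕ} (hq : 2 ≤ q) (Y : Finset (Fin D → Fin q)) (n : ℕ) (hn : n ≤ D) :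
    ∃ (a : ℕ → ℂ) (b : ℂ), ∀ x,
      ∑ z ∈ Y, ((D - hammingDist x z).choose (D - n) : ℂ)
      = ∑ k ∈ range (hDualDeg D q Y), a k * ∑ z ∈ Y, ((D - hammingDist x z).choose (D - k) : ℂ)
        + b := by
  set S := (hDualSet_finite D q Y).toFinset with hS
  have hSD : ∀ j ∈ S, j ≤ D := by
    intro j hj
    rw [hS, Set.Finite.mem_toFinset] at hj
    exact hj.2.1
  have hcard : (S.image (fun j => D - j)).card = hDualDeg D q Y := by
    rw [hDualDeg_eq, card_image_of_injOn]
    intro a ha b hb h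
    have h1 := hSD a ha
    have h2 := hSD b hb
    simp only at h
    omega
  obtain ⟨c, hc⟩ := interp_choose (S.image (fun j => D - j)) (fun m => (m.choose n : ℂ))
  rw [hcard] at hc
  have hq0 : (q : ℂ) ≠ 0 := by exact_mod_cast (by omega : q ≠ 0)
  have hsle := hDualDeg_le (D := D) (q := q) Y
  refine ⟨fun k => ((q : ℂ) ^ (D - n))⁻¹ * c k * (q : ℂ) ^ (D - k),
    ((q : ℂ) ^ (D - n))⁻¹ * ((D.choose n : ℂ) * Y.card -
      ∑ k ∈ range (hDualDeg D q Y), c k * ((D.choose k : ℂ) * Y.card)), fun x => ?_⟩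
  have e1 : ∀ k ≤ D, (q : ℂ) ^ (D - k) * ∑ z ∈ Y, ((D - hammingDist x z).choose (D - k) : ℂ)
      = (D.choose k : ℂ) * Y.card + ∑ j ∈ S, ((D - j).choose k : ℂ) * gG Y j x := by
    intro k hk
    rw [← gG_sum Y k hk, sum_split hq]
  have e2 : ∑ j ∈ S, ((D - j).choose n : ℂ) * gG Y j x
      = ∑ k ∈ range (hDualDeg D q Y), c k * ∑ j ∈ S, ((D - j).choose k : ℂ) * gG Y j x := by
    simp_rw [mul_sum]
    rw [sum_comm]
    refine sum_congr rfl fun j hj => ?_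
    rw [hc (D - j) (mem_image_of_mem _ hj), sum_mul]
    exact sum_congr rfl fun k _ => by ring
  have e3 := e1 n hn
  rw [e2] at e3
  have e4 : ∑ k ∈ range (hDualDeg D q Y), c k * ∑ j ∈ S, ((D - j).choose k : ℂ) * gG Y j x
      = ∑ k ∈ range (hDualDeg D q Y), c k * ((q : ℂ) ^ (D - k) *
          ∑ z ∈ Y, ((D - hammingDist x z).choose (D - k) : ℂ))
        - ∑ k ∈ range (hDualDeg D q Y), c k * ((D.choose k : ℂ) * Y.card) := by
    rw [← sum_sub_distrib]
    refine sum_congr rfl fun k hk => ?_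
    rw [e1 k (by have := mem_range.1 hk; omega)]; ring
  rw [e4] at e3
  have hqn : (q : ℂ) ^ (D - n) ≠ 0 := pow_ne_zero _ hq0
  have e5 : ∑ z ∈ Y, ((D - hammingDist x z).choose (D - n) : ℂ)
      = ((q : ℂ) ^ (D - n))⁻¹ * ((q : ℂ) ^ (D - n) *
        ∑ z ∈ Y, ((D - hammingDist x z).choose (D - n) : ℂ)) := by
    field_simp
  rw [e5, e3]
  have e6 : ∑ k ∈ range (hDualDeg D q Y), ((q : ℂ) ^ (D - n))⁻¹ * c k * (q : ℂ) ^ (D - k) *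
      ∑ z ∈ Y, ((D - hammingDist x z).choose (D - k) : ℂ)
      = ((q : ℂ) ^ (D - n))⁻¹ * ∑ k ∈ range (hDualDeg D q Y), c k * ((q : ℂ) ^ (D - k) *
          ∑ z ∈ Y, ((D - hammingDist x z).choose (D - k) : ℂ)) := by
    rw [mul_sum]
    exact sum_congr rfl fun k _ => by ring
  rw [e6]
  ring

lemma hMinDist_le {D q : ℕ} {Y : Finset (Fin D → Fin q)} {u v : Fin D → Fin q}
    (hu : u ∈ Y) (hv : v ∈ Y) (h : u ≠ v) : hMinDist Y ≤ hammingDist u v :=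
  Nat.sInf_le ⟨hammingDist_ne_zero.2 h, u, hu, v, hv, rfl⟩

/-- Codewords other than `y` completing `x` to a minimum weight word. -/
def cntY {D q : ℕ} (Y : Finset (Fin D → Fin q)) (y x : Fin D → Fin q) (n : ℕ) :
    Finset (Fin D → Fin q) := Y.filter (fun z => z ≠ y ∧ hammingDist x z = n)

open Finset in
lemma cnt_regular {D q : ℕ} (hq : 2 ≤ q) (Y : Finset (Fin D → Fin q)) (e n : ℕ)
    (hn : n + e = hMinDist Y) (hnD : n ≤ D) (hs : hDualDeg D q Y ≤ n) {y x y' x' : Fin D → Fin q}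
    (hy : y ∈ Y) (hy' : y' ∈ Y) (h : hammingDist x y = e) (h' : hammingDist x' y' = e) :
    (cntY Y y x n).card = (cntY Y y' x' n).card := by
  obtain ⟨a, b, hab⟩ := regular_rel hq Y n hnD
  have hsle := hDualDeg_le (D := D) (q := q) Y
  have far : ∀ {y x : Fin D → Fin q}, y ∈ Y → hammingDist x y = e →
      ∀ z ∈ Y.erase y, n ≤ hammingDist x z := by
    intro y x hy h z hz
    rw [mem_erase] at hz
    have h1 := hMinDist_le hy hz.2 hz.1.symm
    have h2 := hammingDist_triangle y x z
    rw [hammingDist_comm y x] at h2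
    omega
  have low : ∀ {y x : Fin D → Fin q}, y ∈ Y → hammingDist x y = e →
      ∀ k ∈ range (hDualDeg D q Y), ∑ z ∈ Y, ((D - hammingDist x z).choose (D - k) : ℂ)
        = ((D - e).choose (D - k) : ℂ) := by
    intro y x hy h k hk
    rw [mem_range] at hk
    rw [← add_sum_erase _ _ hy, h, sum_eq_zero, add_zero]
    intro z hz
    have := far hy h z hz
    rw [Nat.choose_eq_zero_of_lt (by omega)]; simp
  have top : ∀ {y x : Fin D → Fin q}, y ∈ Y → hammingDist x y = e →
      ∑ z ∈ Y, ((D - hammingDist x z).choose (D - n) : ℂ)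
        = ((D - e).choose (D - n) : ℂ) + (cntY Y y x n).card := by
    intro y x hy h
    rw [← add_sum_erase _ _ hy, h]
    congr 1
    have : cntY Y y x n = (Y.erase y).filter (fun z => hammingDist x z = n) := by
      ext z; simp [cntY]; tauto
    rw [this, card_filter, Nat.cast_sum]
    refine sum_congr rfl fun z hz => ?_
    have h1 := far hy h z hz
    have h2 := hammingDist_le_card_fintype (x := x) (y := z)
    simp only [Fintype.card_fin] at h2
    split_ifs with h3
    · rw [h3, Nat.choose_self]
    · rw [Nat.choose_eq_zero_of_lt (by omega)]
  have r1 := hab x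
  have r2 := hab x'
  rw [top hy h, sum_congr rfl (fun k hk => by rw [low hy h k hk])] at r1
  rw [top hy' h', sum_congr rfl (fun k hk => by rw [low hy' h' k hk]), ← r1] at r2
  have := add_left_cancel r2
  exact_mod_cast this.symm

/-- Codewords agreeing with `x` on `T`. -/
def nT {D q : ℕ} (Y : Finset (Fin D → Fin q)) (T : Finset (Fin D)) (x : Fin D → Fin q) :
    Finset (Fin D → Fin q) := Y.filter (fun z => ∀ i ∈ T, z i = x i)

open Finset in
lemma exists_nonconst {D q : ℕ} (hq : 2 ≤ q) (Y : Finset (Fin D → Fin q)) (j : ℕ) (hj : j ≠ 0)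
    (x : Fin D → Fin q) (hx : gG Y j x ≠ 0) :
    ∃ T : Finset (Fin D), T.card = j ∧ ∃ u v, (nT Y T u).card ≠ (nT Y T v).card := by
  by_contra hcon
  push Not at hcon
  apply hx
  unfold gG
  rw [sum_comm]
  refine sum_eq_zero fun T hT => ?_
  have hTc := (mem_powersetCard.1 hT).2
  have hN := hcon T hTc
  have e1 : ∑ z ∈ Y, eT T x z
      = ∑ w : T → Fin q, ∑ z ∈ Y.filter (fun z => (fun i : T => z i) = w), eT T x z :=
    (sum_fiberwise Y (fun z => (fun i : T => z i)) _).symm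
  rw [e1]
  have e2 : ∀ w : T → Fin q, ∑ z ∈ Y.filter (fun z => (fun i : T => z i) = w), eT T x z
      = ((nT Y T x).card : ℂ) * ∏ i : T, (if x i = w i then (q : ℂ) - 1 else -1) := by
    intro w
    rw [sum_congr rfl (g := fun _ => ∏ i : T, (if x i = w i then (q : ℂ) - 1 else -1))]
    · rw [sum_const, nsmul_eq_mul]
      congr 2
      rw [hN x (fun i => if h : i ∈ T then w ⟨i, h⟩ else x i)]
      congr 1
      ext z
      simp only [nT, mem_filter, funext_iff, Subtype.forall]
      refine and_congr_right fun _ => forall_congr' fun i => forall_congr' fun hi => ?_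
      simp [hi]
    · intro z hz
      rw [mem_filter] at hz
      unfold eT
      rw [← prod_coe_sort]
      refine prod_congr rfl fun i _ => ?_
      rw [← hz.2]
  rw [sum_congr rfl fun w _ => e2 w, ← mul_sum]
  have e3 := prod_univ_sum (fun _ : T => (univ : Finset (Fin q)))
    (fun i a => if x i = a then (q : ℂ) - 1 else -1)
  rw [Fintype.piFinset_univ] at e3
  rw [← e3]
  have hne : T.Nonempty := card_ne_zero.1 (by omega)
  obtain ⟨i, hi⟩ := hne
  rw [prod_eq_zero (mem_univ (⟨i, hi⟩ : T)), mul_zero]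
  rw [← add_sum_erase _ _ (mem_univ (x i)), if_pos rfl]
  rw [sum_congr rfl (g := fun _ => (-1 : ℂ))]
  · rw [sum_const, card_erase_of_mem (mem_univ _), card_univ, Fintype.card_fin, nsmul_eq_mul,
      Nat.cast_sub (by omega)]
    simp
  · intro a ha
    rw [if_neg]
    exact fun h => (mem_erase.1 ha).1 h.symm

open Finset in
lemma dist_piecewise {D q : ℕ} (K : Finset (Fin D)) (y w z : Fin D → Fin q)
    (hw : ∀ i ∈ K, w i ≠ y i) :
    hammingDist (fun i => if i ∈ K then w i else y i) z + K.card = hammingDist y z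
      ↔ ∀ i ∈ K, z i = w i := by
  have h1 : hammingDist y z = (K.filter (fun i => y i ≠ z i)).card
      + (Kᶜ.filter (fun i => y i ≠ z i)).card := by
    unfold hammingDist
    rw [← card_union_of_disjoint, ← filter_union, union_compl]
    exact disjoint_filter_filter disjoint_compl_right
  have h2 : hammingDist (fun i => if i ∈ K then w i else y i) z
      = (K.filter (fun i => w i ≠ z i)).card + (Kᶜ.filter (fun i => y i ≠ z i)).card := by
    unfold hammingDist
    rw [← card_union_of_disjoint]
    · congr 1
      ext i
      by_cases hi : i ∈ K <;> simp [hi]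
    · exact disjoint_filter_filter disjoint_compl_right
  have h3 : (K.filter (fun i => y i ≠ z i)).card ≤ K.card := card_filter_le _ _
  rw [h1, h2]
  constructor
  · intro h i hi
    have : (K.filter (fun i => w i ≠ z i)).card = 0 := by omega
    rw [card_eq_zero, filter_eq_empty_iff] at this
    have := this hi
    push Not at this
    exact this.symm
  · intro h
    have a1 : K.filter (fun i => w i ≠ z i) = ∅ := by
      rw [filter_eq_empty_iff]; intro i hi; simp [h i hi]
    have a2 : K.filter (fun i => y i ≠ z i) = K := by
      rw [filter_eq_self]; intro i hi; rw [h i hi]; exact (hw i hi).symm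
    rw [a1, a2, card_empty]; omega

/-- Codewords at minimum distance from `y` agreeing with `w` on `K`. -/
def cov {D q : ℕ} (Y : Finset (Fin D → Fin q)) (y : Fin D → Fin q) (K : Finset (Fin D))
    (w : Fin D → Fin q) : Finset (Fin D → Fin q) :=
  Y.filter (fun z => hammingDist y z = hMinDist Y ∧ ∀ i ∈ K, z i = w i)

open Finset in
lemma dist_piecewise_self {D q : ℕ} (K : Finset (Fin D)) (y w : Fin D → Fin q)
    (hw : ∀ i ∈ K, w i ≠ y i) :
    hammingDist (fun i => if i ∈ K then w i else y i) y = K.card := by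
  unfold hammingDist
  congr 1
  ext i
  by_cases hi : i ∈ K
  · simp [hi, hw i hi]
  · simp [hi]

open Finset in
lemma cov_eq_cnt {D q : ℕ} (Y : Finset (Fin D → Fin q)) (y : Fin D → Fin q)
    (K : Finset (Fin D)) (w : Fin D → Fin q) (hy : y ∈ Y) (hpos : hMinDist Y ≠ 0)
    (hw : ∀ i ∈ K, w i ≠ y i) (n : ℕ) (hn : n + K.card = hMinDist Y) :
    cov Y y K w = cntY Y y (fun i => if i ∈ K then w i else y i) n := by
  ext z
  simp only [cov, cntY, mem_filter]
  refine and_congr_right fun hz => ?_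
  rw [← dist_piecewise K y w z hw]
  constructor
  · rintro ⟨h1, h2⟩
    refine ⟨?_, by omega⟩
    rintro rfl
    rw [hammingDist_self] at h1
    omega
  · rintro ⟨h1, h2⟩
    have h3 := hMinDist_le hy hz h1.symm
    have h4 := hammingDist_triangle y (fun i => if i ∈ K then w i else y i) z
    rw [hammingDist_comm y (fun i => if i ∈ K then w i else y i), dist_piecewise_self K y w hw] at h4
    omega

open Finset in
lemma cov_regular {D q : ℕ} (hq : 2 ≤ q) (Y : Finset (Fin D → Fin q)) (hpos : hMinDist Y ≠ 0)
    {y y' w w' : Fin D → Fin q} {K K' : Finset (Fin D)} (hK : K.card = K'.card)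
    (hs : K.card + hDualDeg D q Y ≤ hMinDist Y) (hD : hMinDist Y ≤ D)
    (hy : y ∈ Y) (hy' : y' ∈ Y)
    (hw : ∀ i ∈ K, w i ≠ y i) (hw' : ∀ i ∈ K', w' i ≠ y' i) :
    (cov Y y K w).card = (cov Y y' K' w').card := by
  rw [cov_eq_cnt Y y K w hy hpos hw (hMinDist Y - K.card) (by omega),
    cov_eq_cnt Y y' K' w' hy' hpos hw' (hMinDist Y - K.card) (by omega)]
  exact cnt_regular hq Y K.card _ (by omega) (by omega) (by omega) hy hy'
    (dist_piecewise_self K y w hw) (by rw [dist_piecewise_self K' y' w' hw', hK])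

open Finset in
lemma nT_eq_of_diff {D q : ℕ} (hq : 2 ≤ q) (Y : Finset (Fin D → Fin q)) (hpos : hMinDist Y ≠ 0)
    (T : Finset (Fin D)) (hs : T.card + hDualDeg D q Y ≤ hMinDist Y) (hD : hMinDist Y ≤ D)
    (l : ℕ) (hl : 0 < l)
    (hreg : ∀ y ∈ Y, ∀ w : Fin D → Fin q, (∀ i ∈ T, w i ≠ y i) → (cov Y y T w).card = l)
    (x x' : Fin D → Fin q) (hxx : ∀ i ∈ T, x i ≠ x' i) :
    (nT Y T x).card = (nT Y T x').card := by
  have := card_mul_eq_card_mul (s := nT Y T x) (t := nT Y T x') (m := l) (n := l)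
    (fun y z => hammingDist y z = hMinDist Y) ?_ ?_
  · exact Nat.eq_of_mul_eq_mul_right hl this
  · intro y hy
    simp only [nT, mem_filter] at hy
    rw [← hreg y hy.1 x' (fun i hi => by rw [hy.2 i hi]; exact (hxx i hi).symm)]
    congr 1
    ext z
    simp only [bipartiteAbove, nT, cov, mem_filter]
    tauto
  · intro z hz
    simp only [nT, mem_filter] at hz
    rw [← hreg z hz.1 x (fun i hi => by rw [hz.2 i hi]; exact (hxx i hi))]
    congr 1
    ext y
    simp only [bipartiteBelow, nT, cov, mem_filter]
    rw [hammingDist_comm z y]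
    tauto

lemma hDualSet_nonempty {D q : ℕ} (hq : 2 ≤ q) (Y : Finset (Fin D → Fin q))
    (hY1 : 1 < Y.card) (hY2 : Y.card < q ^ D) : (hDualSet D q Y).Nonempty := by
  by_contra hne
  rw [Set.not_nonempty_iff_eq_empty] at hne
  have hx : ∃ x, x ∉ Y := by
    by_contra h
    push Not at h
    have : Y = Finset.univ := Finset.eq_univ_iff_forall.2 h
    rw [this, Finset.card_univ] at hY2
    simp at hY2
  obtain ⟨x, hx⟩ := hx
  have h1 := gG_sum Y 0 (Nat.zero_le _) x
  rw [sum_split hq] at h1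
  have hS : (hDualSet_finite D q Y).toFinset = ∅ := by
    rw [Set.Finite.toFinset_eq_empty]; exact hne
  rw [hS, Finset.sum_empty, Finset.sum_eq_zero (s := Y)] at h1
  · simp only [Nat.choose_zero_right, Nat.cast_one, one_mul, add_zero, mul_zero] at h1
    have : Y.card = 0 := by exact_mod_cast h1
    omega
  · intro z hz
    have h0 : hammingDist x z ≠ 0 := hammingDist_ne_zero.2 (by rintro rfl; exact hx hz)
    have h2 := hammingDist_le_card_fintype (x := x) (y := z)
    simp only [Fintype.card_fin] at h2
    rw [Nat.choose_eq_zero_of_lt (by omega)]; simp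

lemma fin2_ne : ∀ a b : Fin 2, a ≠ b ↔ b = a + 1 := by decide

open Finset in
lemma binary_const {D : ℕ} (Y : Finset (Fin D → Fin 2)) (hpos : hMinDist Y ≠ 0)
    (T : Finset (Fin D)) (hs : T.card + hDualDeg D 2 Y ≤ hMinDist Y) (hD : hMinDist Y < D)
    (hT : T.card ≠ 0)
    (u v : Fin D → Fin 2) (hu : u ∈ Y) (hv : v ∈ Y) (huv : hammingDist u v = hMinDist Y)
    (l : ℕ) (hl : 0 < l)
    (hreg : ∀ y ∈ Y, ∀ w : Fin D → Fin 2, (∀ i ∈ T, w i ≠ y i) → (cov Y y T w).card = l)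
    (x x' : Fin D → Fin 2) : (nT Y T x).card = (nT Y T x').card := by
  classical
  -- strict inequality of the covering numbers
  obtain ⟨K0, hK0sub, hK0c⟩ := exists_subset_card_eq
    (s := univ.filter (fun i => u i ≠ v i)) (n := T.card - 1)
    (by change _ ≤ hammingDist u v; omega)
  have hi0 : ∃ i, u i = v i := by
    by_contra h
    push Not at h
    have : hammingDist u v = D := by
      unfold hammingDist
      rw [filter_true_of_mem (fun i _ => h i)]; simp
    omega
  obtain ⟨i0, hi0⟩ := hi0
  have hi0K : i0 ∉ K0 := fun h => by
    have := hK0sub h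
    simp at this
    exact this hi0
  have hK0ne : ∀ i ∈ K0, v i ≠ u i := fun i hi => by
    have := hK0sub hi
    simp at this
    exact fun h => this h.symm
  have hstrict : (cov Y u (insert i0 K0) (fun i => u i + 1)).card < (cov Y u K0 v).card := by
    apply card_lt_card
    rw [ssubset_iff_of_subset]
    · refine ⟨v, ?_, ?_⟩
      · simp only [cov, mem_filter]
        exact ⟨hv, huv, by simp⟩
      · simp only [cov, mem_filter]
        rintro ⟨_, _, h⟩
        have := (fin2_ne (u i0) (v i0)).2 (h i0 (mem_insert_self _ _))
        exact this hi0
    · intro z hz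
      simp only [cov, mem_filter] at hz ⊢
      refine ⟨hz.1, hz.2.1, fun i hi => ?_⟩
      rw [hz.2.2 i (mem_insert_of_mem hi)]
      exact ((fin2_ne _ _).1 (hK0ne i hi).symm).symm
  have hne1 : ∀ a : Fin 2, a + 1 ≠ a := by decide
  have hl1 : (cov Y u (insert i0 K0) (fun i => u i + 1)).card = l := by
    rw [← hreg u hu (fun i => u i + 1) (fun i _ => hne1 _)]
    exact cov_regular le_rfl Y hpos (by rw [card_insert_of_notMem hi0K]; omega)
      (by rw [card_insert_of_notMem hi0K]; omega) hD.le hu hu (fun i _ => hne1 _)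
      (fun i _ => hne1 _)
  rw [hl1] at hstrict
  -- adjacency with one agreeing coordinate
  have hone : ∀ i1 ∈ T, ∀ x x' : Fin D → Fin 2, x i1 = x' i1 →
      (∀ i ∈ T, i ≠ i1 → x i ≠ x' i) → (nT Y T x).card = (nT Y T x').card := by
    intro i1 hi1
    have hcount : ∀ x x' : Fin D → Fin 2, x i1 = x' i1 →
      (∀ i ∈ T, i ≠ i1 → x i ≠ x' i) → ∀ y ∈ nT Y T x,
        ((nT Y T x').filter (fun z => hammingDist y z = hMinDist Y)).card
          = (cov Y u K0 v).card - l := by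
      intro x x' h1 h2 y hy
      simp only [nT, mem_filter] at hy
      have hsub : cov Y y T (fun i => y i + 1) ⊆ cov Y y (T.erase i1) x' := by
        intro z hz
        simp only [cov, mem_filter] at hz ⊢
        refine ⟨hz.1, hz.2.1, fun i hi => ?_⟩
        rw [mem_erase] at hi
        rw [hz.2.2 i hi.2, hy.2 i hi.2]
        exact ((fin2_ne _ _).1 (h2 i hi.2 hi.1)).symm
      have e1 : (nT Y T x').filter (fun z => hammingDist y z = hMinDist Y)
          = cov Y y (T.erase i1) x' \ cov Y y T (fun i => y i + 1) := by
        ext z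
        simp only [nT, cov, mem_filter, mem_sdiff]
        constructor
        · rintro ⟨⟨a, b⟩, c⟩
          refine ⟨⟨a, c, fun i hi => b i (mem_of_mem_erase hi)⟩, ?_⟩
          rintro ⟨_, _, h⟩
          have := h i1 hi1
          rw [b i1 hi1, ← h1, hy.2 i1 hi1] at this
          exact hne1 _ this.symm
        · rintro ⟨⟨a, c, b⟩, h⟩
          refine ⟨⟨a, fun i hi => ?_⟩, c⟩
          by_cases hii : i = i1
          · subst hii
            by_contra hz
            apply h
            refine ⟨a, c, fun k hk => ?_⟩
            by_cases hki : k = i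
            · subst hki
              rw [hy.2 k hk, h1]
              exact (fin2_ne _ _).1 (fun h => hz h.symm)
            · rw [b k (mem_erase.2 ⟨hki, hk⟩), hy.2 k hk]
              exact (fin2_ne _ _).1 (h2 k hk hki)
          · exact b i (mem_erase.2 ⟨hii, hi⟩)
      rw [e1, card_sdiff_of_subset hsub, hreg y hy.1 _ (fun i _ => hne1 _)]
      congr 1
      refine cov_regular le_rfl Y hpos (by rw [card_erase_of_mem hi1]; omega)
        (by rw [card_erase_of_mem hi1]; omega) hD.le hy.1 hu (fun i hi => ?_) hK0ne
      rw [mem_erase] at hi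
      rw [hy.2 i hi.2]
      exact (h2 i hi.2 hi.1).symm
    intro x x' h1 h2
    have := card_mul_eq_card_mul (s := nT Y T x) (t := nT Y T x')
      (m := (cov Y u K0 v).card - l) (n := (cov Y u K0 v).card - l)
      (fun y z => hammingDist y z = hMinDist Y)
      (fun y hy => hcount x x' h1 h2 y hy) (fun z hz => ?_)
    · exact Nat.eq_of_mul_eq_mul_right (by omega) this
    · rw [← hcount x' x h1.symm (fun i hi hii => (h2 i hi hii).symm) z hz]
      congr 1
      ext y
      simp only [bipartiteBelow, mem_filter]
      rw [hammingDist_comm z y]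
  -- flipping one coordinate
  have hflip : ∀ i1 ∈ T, ∀ x : Fin D → Fin 2,
      (nT Y T x).card = (nT Y T (Function.update x i1 (x i1 + 1))).card := by
    intro i1 hi1 x
    rw [nT_eq_of_diff le_rfl Y hpos T hs hD.le l hl hreg x (fun i => x i + 1)
      (fun i _ => (hne1 _).symm)]
    apply hone i1 hi1
    · simp
    · intro i _ hii
      simp [hii]
  have hupd : ∀ i1 ∈ T, ∀ (x : Fin D → Fin 2) (a : Fin 2),
      (nT Y T x).card = (nT Y T (Function.update x i1 a)).card := by
    intro i1 hi1 x a
    by_cases h : x i1 = a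
    · rw [← h, Function.update_eq_self]
    · rw [(fin2_ne _ _).1 h]; exact hflip i1 hi1 x
  have hind : ∀ K : Finset (Fin D), K ⊆ T →
      (nT Y T x).card = (nT Y T (fun i => if i ∈ K then x' i else x i)).card := by
    intro K
    induction K using Finset.induction_on with
    | empty => intro _; simp
    | insert a K ha ih =>
      intro hK
      rw [ih (fun i hi => hK (mem_insert_of_mem hi)), hupd a (hK (mem_insert_self _ _)) _ (x' a)]
      congr 2
      ext i
      by_cases hia : i = a
      · subst hia; simp
      · simp [hia]
  rw [hind T (Subset.refl _)]
  congr 1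
  ext z
  simp only [nT, mem_filter]
  refine and_congr_right fun _ => forall_congr' fun i => forall_congr' fun hi => ?_
  simp [hi]

/-- **Martin's minimum distance bound.** Let `Y` be a code in the Hamming
scheme `H(D,q)` with minimum distance `δ`, dual distance `δ^*`, and dual degree `s^*`.
Then `δ ≤ δ^* + s^* - 1`, unless `q = 2` and `Y` is a binary repetition code
(a pair of words at Hamming distance `D`). -/
theorem martin_minimum_distance_bound
    (D q : ℕ) (hq : 2 ≤ q) (Y : Finset (Fin D → Fin q))
    (hY1 : 1 < Y.card) (hY2 : Y.card < q ^ D) :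
    hMinDist Y ≤ hDualDist D q Y + hDualDeg D q Y - 1 ∨
      (q = 2 ∧ ∃ u v : Fin D → Fin q, u ∈ Y ∧ v ∈ Y ∧ Y = {u, v} ∧
        hammingDist u v = D) := by
  classical
  have hne := hDualSet_nonempty hq Y hY1 hY2
  have hmem : hDualDist D q Y ∈ hDualSet D q Y := Nat.sInf_mem hne
  have hs1 : 0 < hDualDeg D q Y := by
    rw [hDualDeg_eq, Finset.card_pos, Set.Finite.toFinset_nonempty]; exact hne
  rw [mem_hDualSet hq] at hmem
  obtain ⟨hd0, hdD, x0, hx0⟩ := hmem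
  by_cases hle : hMinDist Y ≤ hDualDist D q Y + hDualDeg D q Y - 1
  · exact Or.inl hle
  right
  obtain ⟨T, hTc, p, r, hpr⟩ := exists_nonconst hq Y _ hd0 x0 hx0
  obtain ⟨a, ha, b, hb, hab⟩ := Finset.one_lt_card.1 hY1
  have hmin : hMinDist Y ∈ {i : ℕ | i ≠ 0 ∧ ∃ u ∈ Y, ∃ v ∈ Y, hammingDist u v = i} :=
    Nat.sInf_mem ⟨hammingDist a b, hammingDist_ne_zero.2 hab, a, ha, b, hb, rfl⟩
  obtain ⟨hpos, u, hu, v, hv, huv⟩ := hmin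
  have hD : hMinDist Y ≤ D := by
    have h2 := hammingDist_le_card_fintype (x := u) (y := v)
    simp only [Fintype.card_fin] at h2
    omega
  have hs : T.card + hDualDeg D q Y ≤ hMinDist Y := by omega
  obtain ⟨K, hKsub, hKc⟩ := Finset.exists_subset_card_eq
    (s := Finset.univ.filter (fun i => u i ≠ v i)) (n := T.card)
    (by change _ ≤ hammingDist u v; omega)
  have hKne : ∀ i ∈ K, v i ≠ u i := fun i hi => by
    have := hKsub hi
    simp at this
    exact fun h => this h.symm
  have hl : 0 < (cov Y u K v).card := by
    rw [Finset.card_pos]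
    refine ⟨v, ?_⟩
    simp only [cov, Finset.mem_filter]
    exact ⟨hv, huv, by simp⟩
  have hreg : ∀ y ∈ Y, ∀ w : Fin D → Fin q, (∀ i ∈ T, w i ≠ y i) →
      (cov Y y T w).card = (cov Y u K v).card := fun y hy w hw =>
    cov_regular hq Y hpos hKc.symm hs hD hy hu hw hKne
  have hdiff := nT_eq_of_diff hq Y hpos T hs hD _ hl hreg
  rcases Nat.lt_or_ge 2 q with hq3 | hq2
  · exfalso
    apply hpr
    have hthird : ∀ i : Fin D, ∃ c : Fin q, c ≠ p i ∧ c ≠ r i := by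
      intro i
      obtain ⟨c, _, hc⟩ := Finset.exists_mem_notMem_of_card_lt_card
        (s := {p i, r i}) (t := (Finset.univ : Finset (Fin q))) (by
          have := Finset.card_le_two (a := p i) (b := r i)
          simp only [Finset.card_univ, Fintype.card_fin]; omega)
      simp at hc
      exact ⟨c, hc.1, hc.2⟩
    choose c hc using hthird
    rw [hdiff p c (fun i _ => (hc i).1.symm), hdiff c r (fun i _ => (hc i).2)]
  · obtain rfl : q = 2 := by omega
    refine ⟨rfl, u, v, hu, hv, ?_, ?_⟩
    all_goals
      have hDeq : hMinDist Y = D := by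
        by_contra hlt
        exact hpr (binary_const Y hpos T hs (by omega) (by omega) u v hu hv huv _ hl hreg p r)
    · have hcomp : ∀ w ∈ Y, w ≠ u → ∀ i, w i = u i + 1 := by
        intro w hw hwu i
        have h1 := hMinDist_le hu hw hwu.symm
        rw [hDeq] at h1
        have h2 : Finset.univ.filter (fun i => u i ≠ w i) = Finset.univ := by
          apply Finset.eq_univ_of_card
          have h2 := hammingDist_le_card_fintype (x := u) (y := w)
          change hammingDist u w = _
          simp only [Fintype.card_fin] at h2 ⊢
          omega
        have h3 : i ∈ Finset.univ.filter (fun i => u i ≠ w i) := by rw [h2]; simp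
        simp only [Finset.mem_filter, Finset.mem_univ, true_and] at h3
        exact (fin2_ne _ _).1 h3
      have hvu : v ≠ u := by
        rintro rfl
        rw [hammingDist_self] at huv
        exact hpos huv.symm
      ext w
      simp only [Finset.mem_insert, Finset.mem_singleton]
      constructor
      · intro hw
        by_cases hwu : w = u
        · exact Or.inl hwu
        · right
          funext i
          rw [hcomp w hw hwu, hcomp v hv hvu]
      · rintro (rfl | rfl)
        · exact hu
        · exact hv
    · rw [huv, hDeq]
end
end

section
/- Let Y be a code in the Hamming scheme H(D,q) with minimum distance δ, dual distance δ^*, and degree s = #{i ≠ 0 : ⟨χ_Y, A_iχ_Y⟩ ≠ 0}. Then δ^* ≤ δ + s − 1, unless q = 2 and Y is a bipartite half of H(D,2) (i.e., the set of all even-weight or all odd-weight words, up to translation). -/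
open Matrix

noncomputable section

open Polynomial in
lemma mdb_coeff (c : ℂ) (n k : ℕ) :
    ((1 + C c * X : ℂ[X]) ^ n).coeff k = c ^ k * (n.choose k : ℂ) := by
  have h : (1 + C c * X : ℂ[X]) ^ n = ((1 + X) ^ n : ℂ[X]).comp (C c * X) := by
    simp
  rw [h, Polynomial.comp_C_mul_X_coeff, Polynomial.coeff_one_add_X_pow, mul_comm]

open Polynomial in
lemma mdb_kraw (D q j i : ℕ) :
    kraw D q j i =
      ((1 + C (-1 : ℂ) * X : ℂ[X]) ^ i * (1 + C ((q : ℂ) - 1) * X) ^ (D - i)).coeff j := by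
  rw [Polynomial.coeff_mul, Finset.Nat.sum_antidiagonal_eq_sum_range_succ_mk]
  unfold kraw
  refine Finset.sum_congr rfl fun h _ => ?_
  simp only [mdb_coeff]
  ring

open Polynomial in
/-- Local factor of the generating function of the idempotents. -/
def mdbW {q : ℕ} (a b : Fin q) : ℂ[X] :=
  if a = b then 1 + C ((q : ℂ) - 1) * X else 1 + C (-1 : ℂ) * X

lemma mdb_E (D q j : ℕ) (x z : Fin D → Fin q) :
    hammingE D q j x z = ((q : ℂ) ^ D)⁻¹ * (∏ i, mdbW (x i) (z i)).coeff j := by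
  have h1 : ∏ i, mdbW (x i) (z i) =
      (1 + Polynomial.C (-1 : ℂ) * Polynomial.X) ^ (hammingDist x z) *
        (1 + Polynomial.C ((q : ℂ) - 1) * Polynomial.X) ^ (D - hammingDist x z) := by
    unfold mdbW
    rw [Finset.prod_ite, Finset.prod_const, Finset.prod_const, mul_comm]
    have h2 : (Finset.univ.filter fun i => ¬ x i = z i).card = hammingDist x z := rfl
    have h3 := Finset.card_filter_add_card_filter_not (s := (Finset.univ : Finset (Fin D)))
      (fun i => x i = z i)
    rw [h2] at h3 ⊢
    simp only [Finset.card_univ, Fintype.card_fin] at h3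
    congr 2
    omega
  rw [h1, ← mdb_kraw]
  unfold hammingE hammingA
  have h4 : hammingDist x z ∈ Finset.range (D + 1) := by
    have := hammingDist_le_card_fintype (x := x) (y := z)
    simp at this ⊢
    omega
  simp [Matrix.sum_apply] 
  intro h
  simp at h4
  omega

/-- Indicator of the words agreeing with `p` on `T`. -/
def mdbInd {D q : ℕ} (T : Finset (Fin D)) (p z : Fin D → Fin q) : ℂ :=
  ∏ i, if i ∈ T → z i = p i then 1 else 0

open Polynomial in
lemma mdb_strength (D q t : ℕ) (hq : 2 ≤ q) (Y : Finset (Fin D → Fin q))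
    (hE : ∀ j, 1 ≤ j → j ≤ t → (hammingE D q j).mulVec (chiv Y) = 0)
    (T : Finset (Fin D)) (p : Fin D → Fin q) (hT : T.card ≤ t) :
    (q : ℂ) ^ D * ∑ z ∈ Y, mdbInd T p z = (Y.card : ℂ) * ∑ z, mdbInd T p z := by
  have hq0 : (q : ℂ) ^ D ≠ 0 := by
    apply pow_ne_zero
    exact_mod_cast (by omega : q ≠ 0)
  set Pol : (Fin D → Fin q) → ℂ[X] := fun x => ∑ z, C (mdbInd T p z) * ∏ i, mdbW (z i) (x i)
    with hPol
  have hprod : ∀ x, Pol x =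
      ∏ i, ∑ c, C (if i ∈ T → c = p i then (1:ℂ) else 0) * mdbW c (x i) := by
    intro x
    rw [Finset.prod_univ_sum]
    simp only [hPol, mdbInd, map_prod, Finset.prod_mul_distrib, Fintype.piFinset_univ]
  have hWdeg : ∀ a b : Fin q, (mdbW a b).natDegree ≤ 1 := by
    intro a b
    unfold mdbW
    split_ifs <;> compute_degree
  have hWsum : ∀ b : Fin q, ∑ c, mdbW c b = C (q : ℂ) := by
    intro b
    unfold mdbW
    rw [Finset.sum_ite, Finset.sum_const, Finset.sum_const]
    have h3 := Finset.card_filter_add_card_filter_not (s := (Finset.univ : Finset (Fin q)))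
      (fun i => i = b)
    have h4 : (Finset.univ.filter fun i => i = b).card = 1 := by
      simp [Finset.filter_eq']
    rw [h4] at h3 ⊢
    simp only [Finset.card_univ, Fintype.card_fin] at h3
    have h5 : (q : ℂ) = 1 + ((Finset.univ.filter fun i => ¬ i = b).card : ℂ) := by
      exact_mod_cast h3.symm
    rw [h5]
    simp
    ring
  have hdeg : ∀ x, (Pol x).natDegree ≤ t := by
    intro x
    rw [hprod]
    refine (Polynomial.natDegree_prod_le _ _).trans ?_
    refine le_trans ?_ hT
    have : T.card = ∑ i : Fin D, if i ∈ T then 1 else 0 := by simp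
    rw [this]
    refine Finset.sum_le_sum fun i _ => ?_
    by_cases hi : i ∈ T
    · simp only [hi, if_true]
      refine Polynomial.natDegree_sum_le_of_forall_le _ _ fun c _ => ?_
      exact (Polynomial.natDegree_C_mul_le _ _).trans (hWdeg _ _)
    · simp [hi, hWsum]
  have heval1 : ∀ x, (Pol x).eval 1 = (q : ℂ) ^ D * mdbInd T p x := by
    intro x
    rw [hprod, Polynomial.eval_prod]
    have : (q : ℂ) ^ D = ∏ i : Fin D, (q : ℂ) := by simp
    rw [this, mdbInd, ← Finset.prod_mul_distrib]
    refine Finset.prod_congr rfl fun i _ => ?_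
    rw [Polynomial.eval_finsetSum, Finset.sum_eq_single (x i)]
    · rw [Polynomial.eval_mul, Polynomial.eval_C]
      simp [mdbW]
    · intro b _ hb
      rw [Polynomial.eval_mul, Polynomial.eval_C]
      simp [mdbW, hb]
    · simp
  have hcoeff0 : ∀ x, (Pol x).coeff 0 = ∑ z, mdbInd T p z := by
    intro x
    simp only [hPol, Polynomial.finsetSum_coeff, Polynomial.coeff_C_mul]
    refine Finset.sum_congr rfl fun z _ => ?_
    rw [Polynomial.coeff_zero_prod]
    rw [Finset.prod_eq_one, mul_one]
    intro i _
    unfold mdbW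
    split_ifs <;> simp
  set Q : ℂ[X] := ∑ x ∈ Y, Pol x with hQ
  have hQC : Q = C (Q.coeff 0) := by
    ext j
    rw [Polynomial.coeff_C]
    split_ifs with hj
    · rw [hj]
    · by_cases hjt : j ≤ t
      · simp only [hQ, hPol, Polynomial.finsetSum_coeff, Polynomial.coeff_C_mul]
        rw [Finset.sum_comm]
        refine Finset.sum_eq_zero fun z _ => ?_
        rw [← Finset.mul_sum]
        have h := congrFun (hE j (by omega) hjt) z
        simp only [Matrix.mulVec, dotProduct, mdb_E, chiv, mul_ite, mul_one, mul_zero,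
          Pi.zero_apply, Finset.sum_ite_mem, Finset.univ_inter] at h
        rw [← Finset.mul_sum] at h
        rcases mul_eq_zero.1 h with h | h
        · exact absurd h (inv_ne_zero hq0)
        · rw [h, mul_zero]
      · refine Polynomial.coeff_eq_zero_of_natDegree_lt ?_
        refine lt_of_le_of_lt (Polynomial.natDegree_sum_le_of_forall_le _ _ fun x _ => hdeg x) ?_
        omega
  have h1 : Q.eval 1 = Q.coeff 0 := by
    rw [hQC]; simp
  rw [hQ, Polynomial.eval_finsetSum, Polynomial.finsetSum_coeff] at h1
  simp only [heval1, hcoeff0] at h1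
  rw [Finset.mul_sum, h1]
  simp

lemma mdbInd_eq {D q : ℕ} (T : Finset (Fin D)) (p z : Fin D → Fin q) :
    mdbInd T p z = if ∀ i ∈ T, z i = p i then 1 else 0 := by
  unfold mdbInd
  rw [Finset.prod_ite_zero]
  simp

lemma mdbInd_mul {D q : ℕ} (T : Finset (Fin D)) (p x z : Fin D → Fin q) (i : Fin D) :
    mdbInd T p z * (if z i = x i then 1 else 0) =
      if i ∈ T then (if p i = x i then mdbInd T p z else 0)
      else mdbInd (insert i T) (Function.update p i (x i)) z := by
  simp only [mdbInd_eq]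
  by_cases hi : i ∈ T
  · simp only [hi, if_true]
    by_cases h : ∀ i ∈ T, z i = p i
    · simp [h, h i hi]
    · simp [h]
  · simp only [hi, if_false]
    have : (∀ j ∈ insert i T, z j = Function.update p i (x i) j) ↔
        (z i = x i ∧ ∀ j ∈ T, z j = p j) := by
      rw [Finset.forall_mem_insert]
      simp only [Function.update_self]
      refine and_congr_right fun _ => forall₂_congr fun j hj => ?_
      rw [Function.update_of_ne]
      rintro rfl
      exact hi hj
    simp only [this]
    by_cases h1 : z i = x i <;> simp [h1]

lemma mdb_dist {D q : ℕ} (x z : Fin D → Fin q) :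
    (hammingDist x z : ℂ) = D - ∑ i, (if z i = x i then 1 else 0) := by
  have h3 := Finset.card_filter_add_card_filter_not (s := (Finset.univ : Finset (Fin D)))
      (fun i => z i = x i)
  have h2 : (Finset.univ.filter fun i => ¬ z i = x i).card = hammingDist x z := by
    rw [hammingDist_comm]; rfl
  rw [h2] at h3
  simp only [Finset.card_univ, Fintype.card_fin] at h3
  rw [Finset.sum_boole]
  have h4 : (((Finset.univ.filter fun i => z i = x i).card : ℕ) : ℂ) + (hammingDist x z : ℂ) = D := by
    exact_mod_cast h3
  rw [← h4]
  ring

lemma mdb_poly (D q t : ℕ) (Y : Finset (Fin D → Fin q))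
    (hs : ∀ (T : Finset (Fin D)) (p : Fin D → Fin q), T.card ≤ t →
      (q : ℂ) ^ D * ∑ z ∈ Y, mdbInd T p z = (Y.card : ℂ) * ∑ z, mdbInd T p z)
    (x : Fin D → Fin q) (S : Finset ℕ) :
    ∀ (T : Finset (Fin D)) (p : Fin D → Fin q), T.card + S.card ≤ t →
      (q : ℂ) ^ D * ∑ z ∈ Y, mdbInd T p z * ∏ a ∈ S, ((a : ℂ) - hammingDist x z) =
        (Y.card : ℂ) * ∑ z, mdbInd T p z * ∏ a ∈ S, ((a : ℂ) - hammingDist x z) := by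
  induction S using Finset.induction_on with
  | empty =>
    intro T p h
    simpa using hs T p (by simpa using h)
  | insert a S ha ih =>
    intro T p h
    rw [Finset.card_insert_of_notMem ha] at h
    have key : ∀ z, mdbInd T p z * ∏ b ∈ insert a S, ((b : ℂ) - hammingDist x z) =
        ((a : ℂ) - D) * (mdbInd T p z * ∏ b ∈ S, ((b : ℂ) - hammingDist x z)) +
        ∑ i, (if i ∈ T then (if p i = x i then mdbInd T p z else 0)
          else mdbInd (insert i T) (Function.update p i (x i)) z) *
            ∏ b ∈ S, ((b : ℂ) - hammingDist x z) := by
      intro z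
      rw [Finset.prod_insert ha]
      simp only [← mdbInd_mul]
      rw [← Finset.sum_mul, ← Finset.mul_sum]
      have := mdb_dist x z
      have h2 : (∑ i, (if z i = x i then 1 else 0) : ℂ) = D - hammingDist x z := by
        rw [this]; ring
      rw [h2]
      ring
    simp only [key, Finset.sum_add_distrib, mul_add, ← Finset.mul_sum]
    congr 1
    · rw [mul_left_comm, ih T p (by omega), mul_left_comm]
    · rw [Finset.sum_comm, Finset.sum_comm (s := Finset.univ) (t := Finset.univ),
        Finset.mul_sum, Finset.mul_sum]
      refine Finset.sum_congr rfl fun i _ => ?_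
      by_cases hi : i ∈ T
      · by_cases hp : p i = x i
        · simpa [hi, hp] using ih T p (by omega)
        · simp [hi, hp]
      · simp only [hi, if_false]
        refine ih _ _ ?_
        rw [Finset.card_insert_of_notMem hi]
        omega

open Polynomial in
lemma mdb_phi (D q : ℕ) (x u : Fin D → Fin q) :
    ∑ z, C (mdbInd (Finset.univ.filter fun i => x i ≠ u i) u z) * X ^ (hammingDist x z) =
      (X ^ (hammingDist x u) * (C (q : ℂ) * X + 1 - X) ^ (D - hammingDist x u) : ℂ[X]) := by
  have h1 : ∀ z, C (mdbInd (Finset.univ.filter fun i => x i ≠ u i) u z) * X ^ (hammingDist x z)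
      = ∏ i, (C (if x i ≠ u i → z i = u i then (1:ℂ) else 0) * (if x i ≠ z i then X else 1)) := by
    intro z
    rw [Finset.prod_mul_distrib, mdbInd, map_prod]
    congr 1
    · simp
    · rw [Finset.prod_ite]; simp [hammingDist]
  simp only [h1]
  have h2 := Finset.prod_univ_sum (fun _ : Fin D => (Finset.univ : Finset (Fin q)))
    (fun i c => (C (if x i ≠ u i → c = u i then (1:ℂ) else 0) * (if x i ≠ c then X else 1)))
  rw [Fintype.piFinset_univ] at h2
  rw [← h2]
  have h3 : ∀ i, ∑ c, (C (if x i ≠ u i → c = u i then (1:ℂ) else 0) * (if x i ≠ c then X else 1))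
      = if x i ≠ u i then X else C (q : ℂ) * X + 1 - X := by
    intro i
    by_cases hi : x i = u i
    · have : ∀ c, (if u i = c then (1:ℂ[X]) else X) = X + if u i = c then 1 - X else 0 := by
        intro c; split_ifs <;> ring
      simp [hi, this, Finset.sum_add_distrib]
      ring
    · simp only [ne_eq, hi, not_false_eq_true, forall_const, if_true]
      rw [Finset.sum_eq_single (u i)]
      · simp [hi]
      · intro b _ hb; simp [hb]
      · simp
  simp only [h3]
  rw [Finset.prod_ite, Finset.prod_const, Finset.prod_const]
  have h4 := Finset.card_filter_add_card_filter_not (s := (Finset.univ : Finset (Fin D)))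
      (fun i => x i ≠ u i)
  have h5 : (Finset.univ.filter fun i => x i ≠ u i).card = hammingDist x u := rfl
  rw [h5] at h4 ⊢
  simp only [Finset.card_univ, Fintype.card_fin] at h4
  congr 2
  omega

open Polynomial in
lemma mdb_phi' (D q : ℕ) (h : ℕ → ℂ) (x u x' u' : Fin D → Fin q)
    (he : hammingDist x u = hammingDist x' u') :
    ∑ z, mdbInd (Finset.univ.filter fun i => x i ≠ u i) u z * h (hammingDist x z) =
    ∑ z, mdbInd (Finset.univ.filter fun i => x' i ≠ u' i) u' z * h (hammingDist x' z) := by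
  have h1 := mdb_phi D q x u
  rw [he, ← mdb_phi D q x' u'] at h1
  have h2 := congrArg ((Polynomial.basisMonomials ℂ).constr ℂ h) h1
  have h3 : ∀ (c : ℂ) (n : ℕ), (Polynomial.basisMonomials ℂ).constr ℂ h (C c * X ^ n) = c * h n := by
    intro c n
    rw [← Polynomial.smul_eq_C_mul, map_smul, ← Polynomial.monomial_one_right_eq_X_pow,
      smul_eq_mul]
    have h4 := (Polynomial.basisMonomials ℂ).constr_basis ℂ h n
    rw [Polynomial.coe_basisMonomials] at h4
    rw [h4]
  simpa only [map_sum, h3] using h2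

lemma mdb_step {D q : ℕ} (a y : Fin D → Fin q) (k : ℕ) (hk : k ≤ hammingDist a y) :
    ∃ b, hammingDist a b = k ∧ hammingDist b y = hammingDist a y - k := by
  obtain ⟨T, hT, hc⟩ := Finset.exists_subset_card_eq hk
  refine ⟨T.piecewise y a, ?_, ?_⟩
  · rw [← hc]
    unfold hammingDist
    congr 1
    ext i
    have := @hT i
    by_cases hi : i ∈ T <;> simp_all
  · rw [← hc]
    unfold hammingDist
    rw [← Finset.card_sdiff_of_subset hT]
    congr 1
    ext i
    by_cases hi : i ∈ T <;> simp_all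

lemma mdb_piece {D q : ℕ} (x z : Fin D → Fin q) (h : ∀ i, x i ≠ z i) (T T' : Finset (Fin D)) :
    hammingDist (T.piecewise z x) (T'.piecewise z x) = (symmDiff T T').card := by
  unfold hammingDist
  congr 1
  ext i
  have := h i
  by_cases h1 : i ∈ T <;> by_cases h2 : i ∈ T' <;> simp [h1, h2, Finset.mem_symmDiff, this, this.symm]

lemma mdb_update {D q : ℕ} (u : Fin D → Fin q) (i : Fin D) (c : Fin q) (h : c ≠ u i) :
    hammingDist u (Function.update u i c) = 1 := by
  unfold hammingDist
  rw [Finset.card_eq_one]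
  refine ⟨i, ?_⟩
  ext j
  by_cases hj : j = i
  · subst hj; simp [h.symm]
  · simp [hj]

lemma mdb_comb (D q d : ℕ) (hq : 2 ≤ q) (Y : Finset (Fin D → Fin q))
    (hY1 : Y.Nonempty) (hY2 : Y.card < q ^ D) (hd : 1 ≤ d) (hdD : d < D)
    (hmin : ∀ u ∈ Y, ∀ v ∈ Y, u ≠ v → d ≤ hammingDist u v)
    (hcl : ∀ x ∈ Y, ∀ u, hammingDist x u = d → u ∈ Y) :
    q = 2 ∧ ∃ a : Fin D → Fin q,
        (Y : Set (Fin D → Fin q)) = {y | Even (hammingDist a y)} := by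
  obtain ⟨x, hx⟩ := hY1
  have hmul : ∀ n, ∀ a ∈ Y, ∀ y, hammingDist a y = d * n → y ∈ Y := by
    intro n
    induction n with
    | zero =>
      intro a ha y hy
      have : a = y := by simpa using hy
      exact this ▸ ha
    | succ n ih =>
      intro a ha y hy
      rw [mul_add, mul_one] at hy
      obtain ⟨b, hb1, hb2⟩ := mdb_step a y d (by omega)
      exact ih b (hcl a ha b hb1) y (by omega)
  have hd2 : 2 ≤ d := by
    by_contra hlt
    have hd1 : d = 1 := by omega
    have : Y = Finset.univ := by
      ext y
      simp only [Finset.mem_univ, iff_true]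
      exact hmul (hammingDist x y) x hx y (by rw [hd1, one_mul])
    rw [this] at hY2
    simp at hY2
  have hne : ∀ a : Fin q, ∃ b, a ≠ b := by
    intro a
    haveI : Nontrivial (Fin q) := Fin.nontrivial_iff_two_le.2 hq
    obtain ⟨b, hb⟩ := exists_ne a
    exact ⟨b, hb.symm⟩
  choose g hg using hne
  set z : Fin D → Fin q := fun i => g (x i) with hz
  have hxz : ∀ i, x i ≠ z i := fun i => hg _
  have hpx : ∀ T : Finset (Fin D), hammingDist x (T.piecewise z x) = T.card := by
    intro T
    have := mdb_piece x z hxz ∅ T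
    rw [← Finset.bot_eq_empty, bot_symmDiff] at this
    simpa using this
  have hq2 : q = 2 := by
    by_contra hq3
    obtain ⟨T, -, hT⟩ := Finset.exists_subset_card_eq
      (s := (Finset.univ : Finset (Fin D))) (n := d) (by simp; omega)
    obtain ⟨i, hi⟩ : T.Nonempty := Finset.card_pos.1 (by omega)
    obtain ⟨c, hc⟩ : ∃ c, c ∉ ({x i, z i} : Finset (Fin q)) := by
      by_contra hcon
      push Not at hcon
      have h1 : (Finset.univ : Finset (Fin q)) ⊆ {x i, z i} := fun c _ => hcon c
      have h2 := Finset.card_le_card h1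
      have h3 := Finset.card_le_two (a := x i) (b := z i)
      simp at h2
      omega
    simp only [Finset.mem_insert, Finset.mem_singleton, not_or] at hc
    have hu : T.piecewise z x ∈ Y := hcl x hx _ (by rw [hpx, hT])
    have hu' : T.piecewise (Function.update z i c) x ∈ Y := by
      refine hcl x hx _ ?_
      have hxz' : ∀ j, x j ≠ Function.update z i c j := by
        intro j
        by_cases hj : j = i
        · subst hj; simpa using fun h => hc.1 h.symm
        · simpa [hj] using hxz j
      have := mdb_piece x _ hxz' ∅ T
      rw [← Finset.bot_eq_empty, bot_symmDiff] at this
      simpa [hT] using this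
    have he : T.piecewise (Function.update z i c) x =
        Function.update (T.piecewise z x) i c := by
      ext j
      by_cases hj : j = i
      · subst hj; simp [hi]
      · by_cases hjT : j ∈ T <;> simp [hj, hjT]
    have h1 := mdb_update (T.piecewise z x) i c (by simpa [hi] using hc.2)
    have h2 := hmin _ hu _ hu' (by
      intro h
      rw [← he, ← h] at h1
      simp at h1)
    rw [he, h1] at h2
    omega
  have hdle : d = 2 := by
    obtain ⟨T, -, hT⟩ := Finset.exists_subset_card_eq
      (s := (Finset.univ : Finset (Fin D))) (n := d - 1) (by simp; omega)
    obtain ⟨i, hi, j, hj, hij⟩ : ∃ i ∈ Tᶜ, ∃ j ∈ Tᶜ, i ≠ j := by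
      refine Finset.one_lt_card.1 ?_
      rw [Finset.card_compl, hT]
      simp
      omega
    rw [Finset.mem_compl] at hi hj
    have h1 : (insert i T).piecewise z x ∈ Y := hcl x hx _ (by
      rw [hpx, Finset.card_insert_of_notMem hi]; omega)
    have h2 : (insert j T).piecewise z x ∈ Y := hcl x hx _ (by
      rw [hpx, Finset.card_insert_of_notMem hj]; omega)
    have h3 := mdb_piece x z hxz (insert i T) (insert j T)
    have h4 : symmDiff (insert i T) (insert j T) = {i, j} := by
      ext k
      simp only [Finset.mem_symmDiff, Finset.mem_insert, Finset.mem_singleton]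
      by_cases hk : k ∈ T
      · have : k ≠ i := by rintro rfl; exact hi hk
        have : k ≠ j := by rintro rfl; exact hj hk
        simp_all
      · by_cases k = i <;> by_cases k = j <;> simp_all
    rw [h4, Finset.card_pair hij] at h3
    have h5 := hmin _ h1 _ h2 (by intro h; rw [h] at h3; simp at h3)
    omega
  refine ⟨hq2, x, ?_⟩
  have hev : ∀ y, Even (hammingDist x y) → y ∈ Y := by
    rintro y ⟨n, hn⟩
    exact hmul n x hx y (by rw [hdle]; omega)
  ext y
  simp only [Finset.mem_coe, Set.mem_ofPred_eq]
  refine ⟨fun hy => ?_, hev y⟩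
  by_contra hodd
  rw [Nat.not_even_iff_odd] at hodd
  obtain ⟨n, hn⟩ := hodd
  obtain ⟨b, hb1, hb2⟩ := mdb_step x y (2 * n) (by omega)
  have hb : b ∈ Y := hev b (by rw [hb1]; simp)
  have := hmin b hb y hy (by rintro rfl; omega)
  omega

/-- **dual of Martin's bound.** Let `Y` be a code in the Hamming scheme
`H(D,q)` with minimum distance `δ`, dual distance `δ^*`, and degree `s`.  Then
`δ^* ≤ δ + s - 1`, unless `q = 2` and `Y` is a bipartite half of `H(D,2)` (the set of
all words at even Hamming distance from some fixed word). -/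
theorem martin_dual_distance_bound
    (D q : ℕ) (hq : 2 ≤ q) (Y : Finset (Fin D → Fin q))
    (hY1 : 1 < Y.card) (hY2 : Y.card < q ^ D) :
    hDualDist D q Y ≤ hMinDist Y + hDeg Y - 1 ∨
      (q = 2 ∧ ∃ a : Fin D → Fin q,
        (Y : Set (Fin D → Fin q)) = {y | Even (hammingDist a y)}) := by
  rw [or_iff_not_imp_left]
  intro hcon
  rw [not_le] at hcon
  set S : Set ℕ := {i : ℕ | i ≠ 0 ∧ ∃ u ∈ Y, ∃ v ∈ Y, hammingDist u v = i} with hS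
  have hSfin : S.Finite := by
    refine (Set.finite_Iic D).subset ?_
    rintro i ⟨-, u, -, v, -, rfl⟩
    simpa using hammingDist_le_card_fintype (x := u) (y := v)
  have hSne : S.Nonempty := by
    obtain ⟨u, hu, v, hv, huv⟩ := Finset.one_lt_card.1 hY1
    exact ⟨hammingDist u v, by simpa using huv, u, hu, v, hv, rfl⟩
  set d := hMinDist Y with hd
  have hdS : d ∈ S := Nat.sInf_mem hSne
  have hmin : ∀ u ∈ Y, ∀ v ∈ Y, u ≠ v → d ≤ hammingDist u v := fun u hu v hv huv =>
    Nat.sInf_le ⟨by simpa using huv, u, hu, v, hv, rfl⟩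
  have hd1 : 1 ≤ d := Nat.one_le_iff_ne_zero.2 hdS.1
  set F := hSfin.toFinset with hF
  have hdeg : hDeg Y = F.card := Set.ncard_eq_toFinset_card S hSfin
  have hdF : d ∈ F := by simpa [hF] using hdS
  have hFc : (F.erase d).card + 1 = F.card := Finset.card_erase_add_one hdF
  rw [hdeg] at hcon
  have hne : (hDualSet D q Y).Nonempty := by
    refine Nat.nonempty_of_pos_sInf ?_
    change 0 < hDualDist D q Y
    omega
  have hdD : hDualDist D q Y ≤ D := (Nat.sInf_mem hne).2.1
  have hE : ∀ j, 1 ≤ j → j ≤ hDualDist D q Y - 1 →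
      (hammingE D q j).mulVec (chiv Y) = 0 := by
    intro j hj1 hj2
    by_contra h
    have : hDualDist D q Y ≤ j := Nat.sInf_le ⟨by omega, by omega, h⟩
    omega
  have hstr := mdb_strength D q _ hq Y hE
  have hq0 : (q : ℂ) ^ D ≠ 0 := by
    apply pow_ne_zero
    exact_mod_cast (by omega : q ≠ 0)
  set G : ℕ → ℂ := fun n => ∏ a ∈ F.erase d, ((a : ℂ) - n) with hG
  have hGd : G d ≠ 0 := by
    rw [hG]
    refine Finset.prod_ne_zero_iff.2 fun a ha => ?_
    rw [sub_ne_zero]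
    exact_mod_cast (Finset.mem_erase.1 ha).1
  have hmain : ∀ x ∈ Y, ∀ u, hammingDist x u = d →
      (q : ℂ) ^ D * (if u ∈ Y then G d else 0) = (Y.card : ℂ) *
        ∑ z, mdbInd (Finset.univ.filter fun i => x i ≠ u i) u z * G (hammingDist x z) := by
    intro x hx u hu
    rw [← mdb_poly D q _ Y hstr x (F.erase d) (Finset.univ.filter fun i => x i ≠ u i) u (by
      change hammingDist x u + _ ≤ _
      omega)]
    congr 1
    have hz : ∀ z ∈ Y, z ≠ u → mdbInd (Finset.univ.filter fun i => x i ≠ u i) u z *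
        ∏ a ∈ F.erase d, ((a : ℂ) - hammingDist x z) = 0 := by
      intro z hz hzu
      rw [mdbInd_eq]
      split_ifs with hag
      · rw [one_mul]
        simp only [Finset.mem_filter, Finset.mem_univ, true_and] at hag
        have hsub : (Finset.univ.filter fun i => x i ≠ u i) ⊆
            (Finset.univ.filter fun i => x i ≠ z i) := by
          intro i hi
          simp only [Finset.mem_filter, Finset.mem_univ, true_and] at hi ⊢
          rw [hag i hi]; exact hi
        have hlt : d ≠ hammingDist x z := by
          intro h
          have heq := Finset.eq_of_subset_of_card_le hsub (by
            change hammingDist x z ≤ hammingDist x u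
            omega)
          apply hzu
          ext1 i
          by_cases hi : x i = u i
          · have : i ∉ (Finset.univ.filter fun i => x i ≠ z i) := by
              rw [← heq]; simp [hi]
            simp only [Finset.mem_filter, Finset.mem_univ, true_and, not_not, ne_eq] at this
            rw [← this, hi]
          · exact hag i hi
        have hxz : x ≠ z := by
          rintro rfl
          have h0 : (Finset.univ.filter fun i => x i ≠ u i).card = d := hu
          have := Finset.card_le_card hsub
          simp at this
          simp [this] at h0
          omega
        refine Finset.prod_eq_zero (i := hammingDist x z) ?_ (sub_self _)
        refine Finset.mem_erase.2 ⟨hlt.symm, ?_⟩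
        rw [hF, Set.Finite.mem_toFinset]
        exact ⟨by simpa using hxz, x, hx, z, hz, rfl⟩
      · rw [zero_mul]
    split_ifs with huY
    · rw [Finset.sum_eq_single_of_mem u huY hz, mdbInd_eq, hu]
      simp [hG]
    · symm
      exact Finset.sum_eq_zero fun z hzY => hz z hzY (by rintro rfl; exact huY hzY)
  refine mdb_comb D q d hq Y (Finset.card_pos.1 (by omega)) hY2 hd1 (by omega) hmin ?_
  intro x hx u hu
  obtain ⟨-, x0, hx0, u0, hu0, h0⟩ := hdS
  have h1 := hmain x hx u hu
  have h2 := hmain x0 hx0 u0 h0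
  rw [mdb_phi' D q G x u x0 u0 (by rw [hu, h0]), ← h2] at h1
  by_contra huY
  simp [huY, hu0] at h1
  rcases h1 with h | h
  · omega
  · exact hGd h
end
end
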